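/- Let M be a monotone model of dimension n, x ∈ {0,1}^n, δ ∈ (0,1], and let y ⊆ x be a δ-sufficient reason for x under M with y[i] = ⊥ for some index i. For b ∈ {0,1}, let y∪(i→b) denote the partial instance equal to y except that component i is set to b. Then: (1) if M(x) = 1 and x[i] = 1, the partial instance y∪(i→1) is also a δ-sufficient reason for x under M; and (2) if M(x) = 0 and x[i] = 0, the partial instance y∪(i→0) is also a δ-sufficient reason for x under M. -/

import Mathlib

/-- A partial instance `y` is subsumed by a (total) instance `x`. -/
def SubsumesT {α : Type} (y : α → Option Bool) (x : α → Bool) : Prop :=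
  ∀ i, ∀ b : Bool, y i = some b → x i = b

/-- The set of completions of a partial instance `y`. -/
def Comp {α : Type} [Fintype α] [DecidableEq α] (y : α → Option Bool) :
    Finset (α → Bool) :=
  Finset.univ.filter (fun z => ∀ i, ∀ b : Bool, y i = some b → z i = b)

/-- The number of undefined components of a partial instance. -/
def numUndef {α : Type} [Fintype α] [DecidableEq α] (y : α → Option Bool) : ℕ :=
  (Finset.univ.filter (fun i => y i = none)).card

/-- `y` is a `δ`-sufficient reason for `x` under the model `M`. -/
def IsDeltaSR {α : Type} [Fintype α] [DecidableEq α]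
    (M : (α → Bool) → Bool) (x : α → Bool) (δ : ℝ) (y : α → Option Bool) : Prop :=
  SubsumesT y x ∧
    δ * 2 ^ numUndef y ≤ (((Comp y).filter (fun z => M z = M x)).card : ℝ)

theorem numUndef_update_some {α : Type} [Fintype α] [DecidableEq α]
    (y : α → Option Bool) (i : α) (hi : y i = none) (b : Bool) :
    numUndef y = numUndef (Function.update y i (some b)) + 1 := by
  have h : Finset.univ.filter (fun j => y j = none) =
      insert i (Finset.univ.filter (fun j => Function.update y i (some b) j = none)) := by
    ext j
    by_cases hj : j = i
    · subst hj; simp [hi]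
    · simp [hj]
  unfold numUndef
  rw [h, Finset.card_insert_of_notMem (by simp)]

theorem update_mem_comp_update {α : Type} [Fintype α] [DecidableEq α]
    {y : α → Option Bool} {z : α → Bool} (hz : z ∈ Comp y) (i : α) (b : Bool) :
    Function.update z i b ∈ Comp (Function.update y i (some b)) := by
  simp only [Comp, Finset.mem_filter, Finset.mem_univ, true_and] at hz ⊢
  intro j c hc
  by_cases hj : j = i
  · subst hj; simpa using hc
  · simp only [Function.update_of_ne hj] at hc ⊢
    exact hz j c hc

/-- Fixing an undefined feature `i` to `x i` preserves `δ`-sufficiency whenever setting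
feature `i` to `x i` preserves agreement with the verdict on `x`. -/
theorem IsDeltaSR.update {α : Type} [Fintype α] [DecidableEq α]
    {M : (α → Bool) → Bool} {x : α → Bool} {δ : ℝ} {y : α → Option Bool}
    (hSR : IsDeltaSR M x δ y) {i : α} (hi : y i = none)
    (hM : ∀ z, M z = M x → M (Function.update z i (x i)) = M x) :
    IsDeltaSR M x δ (Function.update y i (some (x i))) := by
  obtain ⟨hsub, hcard⟩ := hSR
  refine ⟨fun j c hc => ?_, ?_⟩
  · by_cases hj : j = i
    · subst hj; simpa using hc
    · exact hsub j c (by simpa [hj] using hc)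
  · have hle : ((Comp y).filter (fun z => M z = M x)).card ≤
        (((Comp (Function.update y i (some (x i)))).filter (fun z => M z = M x)) ×ˢ
          (Finset.univ : Finset Bool)).card := by
      refine Finset.card_le_card_of_injOn
        (fun z => (Function.update z i (x i), z i)) ?_ ?_
      · intro z hz
        simp only [Finset.mem_coe, Finset.mem_filter] at hz
        simp only [Finset.mem_coe, Finset.mem_product, Finset.mem_filter, Finset.mem_univ,
          and_true]
        exact ⟨update_mem_comp_update hz.1 i (x i), hM z hz.2⟩
      · intro z _ w _ h
        obtain ⟨h₁, h₂⟩ := Prod.mk.inj h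
        funext j
        by_cases hj : j = i
        · subst hj; exact h₂
        · simpa [hj] using congrFun h₁ j
    rw [Finset.card_product, Finset.card_univ, Fintype.card_bool] at hle
    have hle' := (Nat.cast_le (α := ℝ)).2 hle
    rw [numUndef_update_some y i hi (x i), pow_succ] at hcard
    push_cast at hle'
    linarith

/-- For a monotone model `M`, if `y ⊆ x` is a `δ`-SR for `x` under `M` with
`y i = ⊥`, then: (1) if `M x = 1` and `x i = 1`, fixing `i` to `1` yields a
`δ`-SR; (2) if `M x = 0` and `x i = 0`, fixing `i` to `0` yields a `δ`-SR. -/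
theorem stmt3 {n : ℕ} (M : (Fin n → Bool) → Bool)
    (hmono : ∀ x z : Fin n → Bool, (∀ i, x i ≤ z i) → M x ≤ M z)
    (x : Fin n → Bool) (δ : ℝ) (hδ0 : 0 < δ) (hδ1 : δ ≤ 1)
    (y : Fin n → Option Bool) (i : Fin n) (hi : y i = none)
    (hSR : IsDeltaSR M x δ y) :
    (M x = true → x i = true →
      IsDeltaSR M x δ (Function.update y i (some true))) ∧
    (M x = false → x i = false →
      IsDeltaSR M x δ (Function.update y i (some false))) := by
  refine ⟨fun hMx hxi => ?_, fun hMx hxi => ?_⟩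
  · rw [← hxi]
    refine hSR.update hi fun z hz => ?_
    have h := hmono z (Function.update z i (x i)) fun j => by
      by_cases hj : j = i
      · subst hj; simp [hxi, Bool.le_true]
      · simp [hj]
    rw [hz, hMx] at h
    rw [hMx]
    exact Bool.eq_true_of_true_le h
  · rw [← hxi]
    refine hSR.update hi fun z hz => ?_
    have h := hmono (Function.update z i (x i)) z fun j => by
      by_cases hj : j = i
      · subst hj; simp [hxi, Bool.false_le]
      · simp [hj]
    rw [hz, hMx] at h
    rw [hMx]
    exact Bool.eq_false_of_le_false h
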